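/- arXiv:math/0509102 — 8 statements merged into one kernel-verified Lean document; each statement's English description precedes it below -/
import Mathlib

section
/- Let J and K be small categories such that colimits of shape J commute with limits of shape Kᵒᵖ in Type, i.e. for every functor F : J × Kᵒᵖ ⥤ Type the canonical comparison morphism from the colimit over J of the limits over Kᵒᵖ to the limit over Kᵒᵖ of the colimits over J is an isomorphism. Let A be a locally small category and S : K ⥤ A a diagram admitting a colimit in A, such that for every object k of K the functor Hom_A(S k, −) : A ⥤ Type preserves colimits of shape J. Then Hom_A(colim S, −) : A ⥤ Type preserves colimits of shape J. -/
open CategoryTheory CategoryTheory.Limits Opposite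

universe u u₂

theorem aux {J L : Type*} [Category J] [Category L] {C : Type*} [Category C]
    [HasLimitsOfShape L C] [HasColimitsOfShape J C]
    (H : L × J ⥤ C) [IsIso (colimitLimitToLimitColimit H)]
    (P : J ⥤ C)
    (p : ∀ j, (Functor.const L).obj (P.obj j) ⟶
      (Functor.curry.obj (CategoryTheory.Prod.swap J L ⋙ H)).obj j)
    (hp : ∀ j, IsLimit (Cone.mk _ (p j)))
    (hpn : ∀ {j j' : J} (f : j ⟶ j') (l : L), P.map f ≫ (p j').app l =
      (p j).app l ≫ ((Functor.curry.obj (CategoryTheory.Prod.swap J L ⋙ H)).map f).app l)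
    (Q : L ⥤ C)
    (q : ∀ l, (Functor.curry.obj H).obj l ⟶ (Functor.const J).obj (Q.obj l))
    (hq : ∀ l, IsColimit (Cocone.mk _ (q l)))
    (hqn : ∀ {l l' : L} (f : l ⟶ l') (j : J), (q l).app j ≫ Q.map f =
      ((Functor.curry.obj H).map f).app j ≫ (q l').app j)
    (x : Cone Q) (hx : IsLimit x) (t : Cocone P) (e : t.pt ≅ x.pt)
    (ht : ∀ j l, t.ι.app j ≫ e.hom ≫ x.π.app l = (p j).app l ≫ (q l).app j) :
    Nonempty (IsColimit t) := by
  let α : P ≅ Functor.curry.obj (CategoryTheory.Prod.swap J L ⋙ H) ⋙ lim :=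
    NatIso.ofComponents
      (fun j => (hp j).conePointUniqueUpToIso (limit.isLimit _)) (by
      intro j j' f
      refine limit.hom_ext fun l => ?_
      have h1 := (hp j).conePointUniqueUpToIso_hom_comp (limit.isLimit _) l
      have h2 := (hp j').conePointUniqueUpToIso_hom_comp (limit.isLimit _) l
      dsimp only [limit.cone_π] at h1 h2
      simp only [Category.assoc, Functor.comp_map, lim_map, limMap_π]
      erw [h2, reassoc_of% h1]
      exact hpn f l)
  have hα (j : J) (l : L) : α.hom.app j ≫ limit.π _ l = (p j).app l :=
    (hp j).conePointUniqueUpToIso_hom_comp (limit.isLimit _) l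
  let δ : Functor.curry.obj H ⋙ colim ≅ Q :=
    NatIso.ofComponents (fun l => (colimit.isColimit _).coconePointUniqueUpToIso (hq l)) (by
      intro l l' f
      refine colimit.hom_ext fun j => ?_
      have h1 := (colimit.isColimit _).comp_coconePointUniqueUpToIso_hom (hq l) j
      have h2 := (colimit.isColimit _).comp_coconePointUniqueUpToIso_hom (hq l') j
      dsimp only [colimit.cocone_ι] at h1 h2
      simp only [Functor.comp_map, colim_map, ι_colimMap_assoc]
      erw [h2, reassoc_of% h1]
      exact (hqn f j).symm)
  have hδ (j : J) (l : L) : colimit.ι _ j ≫ δ.hom.app l = (q l).app j :=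
    (colimit.isColimit _).comp_coconePointUniqueUpToIso_hom (hq l) j
  clear_value α δ
  let r := (IsColimit.precomposeHomEquiv α _).symm (colimit.isColimit _)
  have key : r.desc t =
      colimitLimitToLimitColimit H ≫ (lim.mapIso δ ≪≫
        (limit.isLimit Q).conePointUniqueUpToIso hx ≪≫ e.symm).hom := by
    refine r.hom_ext fun j => ?_
    rw [r.fac, ← cancel_mono e.hom]
    refine hx.hom_ext fun l => ?_
    have h3 := (limit.isLimit Q).conePointUniqueUpToIso_hom_comp hx l
    have h4 := ι_colimitLimitToLimitColimit_π H l j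
    simp only [Category.assoc, ht, Iso.trans_hom, Iso.symm_hom, Iso.inv_hom_id_assoc, h3,
      Functor.mapIso_hom, lim_map, limit.cone_π, limMap_π, Cocone.precompose_obj_ι,
      NatTrans.comp_app, colimit.cocone_ι]
    rw [reassoc_of% h4, ← hα, ← hδ, Category.assoc]
  have : IsIso (r.desc t) := by
    rw [key]; infer_instance
  exact ⟨IsColimit.ofPointIso r⟩

theorem stmt3 (J K : Type u) [SmallCategory J] [SmallCategory K]
    (hcomm : ∀ F : J × Kᵒᵖ ⥤ Type u,
      IsIso (colimitLimitToLimitColimit (CategoryTheory.Prod.swap Kᵒᵖ J ⋙ F)))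
    (A : Type u₂) [Category.{u} A] (S : K ⥤ A) [HasColimit S]
    (hS : ∀ k : K, PreservesColimitsOfShape J (coyoneda.obj (op (S.obj k)))) :
    PreservesColimitsOfShape J (coyoneda.obj (op (colimit S))) := by
  refine ⟨fun {D} => ⟨fun {c} hc => ?_⟩⟩
  let F : J × Kᵒᵖ ⥤ Type u := CategoryTheory.Prod.swap J Kᵒᵖ ⋙ S.op.prod D ⋙ Functor.hom A
  let H := CategoryTheory.Prod.swap Kᵒᵖ J ⋙ F
  have : IsIso (colimitLimitToLimitColimit H) := hcomm F
  let a (j : J) : S.op ⋙ yoneda.obj (D.obj j) ≅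
      (Functor.curry.obj (CategoryTheory.Prod.swap J Kᵒᵖ ⋙ H)).obj j :=
    NatIso.ofComponents (fun k => Iso.refl (S.obj k.unop ⟶ D.obj j)) (by
      intro k k' f; ext (x : S.obj k.unop ⟶ D.obj j)
      change S.map f.unop ≫ x = S.map f.unop ≫ x ≫ D.map (𝟙 j)
      simp)
  let b (k : Kᵒᵖ) : D ⋙ coyoneda.obj (op (S.obj k.unop)) ≅ (Functor.curry.obj H).obj k :=
    NatIso.ofComponents (fun j => Iso.refl (S.obj k.unop ⟶ D.obj j)) (by
      intro j j' f; ext (x : S.obj k.unop ⟶ D.obj j)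
      change x ≫ D.map f = S.map (𝟙 k.unop) ≫ x ≫ D.map f
      simp)
  have hb (k : Kᵒᵖ) : IsColimit ((coyoneda.obj (op (S.obj k.unop))).mapCocone c) :=
    isColimitOfPreserves _ hc
  have ha (X : A) : IsLimit ((yoneda.obj X).mapCone (colimit.cocone S).op) :=
    isLimitOfPreserves _ (colimit.isColimit S).op
  refine aux H (D ⋙ coyoneda.obj (op (colimit S)))
    (fun j => ((yoneda.obj (D.obj j)).mapCone (colimit.cocone S).op).π ≫ (a j).hom)
    (fun j => (IsLimit.postcomposeHomEquiv (a j) _).symm (ha (D.obj j)))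
    ?_
    (S.op ⋙ yoneda.obj c.pt)
    (fun k => (b k).inv ≫ ((coyoneda.obj (op (S.obj k.unop))).mapCocone c).ι)
    (fun k => (IsColimit.precomposeInvEquiv (b k) _).symm (hb k))
    ?_ _ (ha c.pt) ((coyoneda.obj (op (colimit S))).mapCocone c) (Iso.refl _) ?_
  · intro j j' f k
    ext (x : colimit S ⟶ D.obj j)
    change colimit.ι S k.unop ≫ x ≫ D.map f =
      S.map (𝟙 k.unop) ≫ (colimit.ι S k.unop ≫ x) ≫ D.map f
    simp
  · intro k k' f j
    ext (x : S.obj k.unop ⟶ D.obj j)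
    change S.map f.unop ≫ x ≫ c.ι.app j =
      (S.map f.unop ≫ x ≫ D.map (𝟙 j)) ≫ c.ι.app j
    simp
  · intro j k
    ext (x : colimit S ⟶ D.obj j)
    change colimit.ι S k.unop ≫ x ≫ c.ι.app j = (colimit.ι S k.unop ≫ x) ≫ c.ι.app j
    simp
end

section
/- Let B be a small category and φ : Bᵒᵖ ⥤ Type a presheaf. Write Dφ := (CostructuredArrow.proj yoneda φ) ⋙ yoneda : (CostructuredArrow yoneda φ) ⥤ (Bᵒᵖ ⥤ Type) for the canonical diagram of representables whose colimit is φ. Then the functor Hom(φ, −) : (Bᵒᵖ ⥤ Type) ⥤ Type (the covariant hom-functor of φ, i.e. coyoneda applied to φ) preserves all small colimits if and only if it preserves the colimit of the diagram Dφ. -/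
open CategoryTheory CategoryTheory.Limits Opposite

universe u

theorem preservesColimit_of_retract_aux {J C D : Type*} [Category J] [Category C] [Category D]
    {F G : C ⥤ D} (i : F ⟶ G) (r : G ⟶ F) (h : i ≫ r = 𝟙 F) (K : J ⥤ C)
    [PreservesColimit K G] : PreservesColimit K F where
  preserves {c} hc := by
    have hG := isColimitOfPreserves G hc
    have h' (X : C) : i.app X ≫ r.app X = 𝟙 _ := by
      rw [← NatTrans.comp_app, h, NatTrans.id_app]
    let T (t : Cocone (K ⋙ F)) : Cocone (K ⋙ G) :=
      (Cocone.precompose (Functor.whiskerLeft K r)).obj t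
    have hT (t : Cocone (K ⋙ F)) (j : J) :
        G.map (c.ι.app j) ≫ hG.desc (T t) = r.app (K.obj j) ≫ t.ι.app j := hG.fac (T t) j
    have hi (j : J) : F.map (c.ι.app j) ≫ i.app c.pt = i.app (K.obj j) ≫ G.map (c.ι.app j) :=
      i.naturality (X := K.obj j) (Y := c.pt) (c.ι.app j)
    have hr (j : J) : G.map (c.ι.app j) ≫ r.app c.pt = r.app (K.obj j) ≫ F.map (c.ι.app j) :=
      r.naturality (X := K.obj j) (Y := c.pt) (c.ι.app j)
    exact ⟨{
      desc := fun t => i.app c.pt ≫ hG.desc (T t)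
      fac := fun t j => by
        change F.map (c.ι.app j) ≫ i.app c.pt ≫ hG.desc (T t) = _
        rw [← Category.assoc, hi, Category.assoc, hT, ← Category.assoc, h']
        exact Category.id_comp _
      uniq := fun t m hm => by
        have : r.app c.pt ≫ m = hG.desc (T t) := by
          refine hG.uniq (T t) _ fun j => ?_
          change G.map (c.ι.app j) ≫ r.app c.pt ≫ m = r.app (K.obj j) ≫ t.ι.app j
          rw [← hm j, ← Category.assoc, hr, Category.assoc]
          rfl
        rw [← this, ← Category.assoc, h']
        exact (Category.id_comp _).symm }⟩

/-- For a presheaf `φ` on a small category `B`, the hom-functor `Hom(φ, -)` preserves all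
small colimits if and only if it preserves the colimit of the canonical diagram of
representables over the category of elements of `φ`. -/
theorem stmt4 (B : Type u) [SmallCategory B] (φ : Bᵒᵖ ⥤ Type u) :
    (∀ (J : Type u) (_ : SmallCategory J),
      PreservesColimitsOfShape J (coyoneda.obj (op φ))) ↔
    PreservesColimit (CostructuredArrow.proj yoneda φ ⋙ yoneda) (coyoneda.obj (op φ)) := by
  constructor
  · intro h
    have := h (CostructuredArrow yoneda φ) inferInstance
    infer_instance
  · intro h J _
    obtain ⟨j, s, hs⟩ := Types.jointly_surjective _
      (isColimitOfPreserves (coyoneda.obj (op φ)) (Presheaf.isColimitTautologicalCocone φ)) (𝟙 φ)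
    change φ ⟶ yoneda.obj j.left at s
    replace hs : s ≫ j.hom = 𝟙 φ := hs
    have e : (evaluation Bᵒᵖ (Type u)).obj (op j.left) ≅ coyoneda.obj (op (yoneda.obj j.left)) :=
      NatIso.ofComponents (fun P => (yonedaEquiv (F := P)).symm.toIso) (by
        intro P Q f
        ext x
        apply yonedaEquiv.injective
        simp [yonedaEquiv_comp])
    have : PreservesColimitsOfShape J (coyoneda.obj (op (yoneda.obj j.left))) :=
      preservesColimitsOfShape_of_natIso e
    constructor
    intro K
    refine preservesColimit_of_retract_aux (coyoneda.map j.hom.op) (coyoneda.map s.op) ?_ K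
    rw [← Functor.map_comp, ← op_comp, hs]
    simp
end

section
/- Let B be a small category and φ : Bᵒᵖ ⥤ Type a presheaf. Then the hom-functor Hom(φ, −) : (Bᵒᵖ ⥤ Type) ⥤ Type preserves all small colimits if and only if φ is a retract of a representable presheaf, i.e. there exist an object b of B and morphisms i : φ ⟶ yoneda.obj b and r : yoneda.obj b ⟶ φ with i ≫ r = 𝟙 φ. -/
open CategoryTheory CategoryTheory.Limits Opposite

universe u

theorem cocone_aux1 {C D : Type*} [Category* C] [Category* D] {F G : C ⥤ D}
    (α : F ⟶ G) (β : G ⟶ F) (h : α ≫ β = 𝟙 F) {X Y : C} (f : X ⟶ Y) {Z : D}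
    (d : G.obj Y ⟶ Z) (k : F.obj X ⟶ Z) (h1 : G.map f ≫ d = β.app X ≫ k) :
    F.map f ≫ α.app Y ≫ d = k := by
  rw [α.naturality_assoc, h1, ← Category.assoc, ← NatTrans.comp_app, h, NatTrans.id_app,
    Category.id_comp]

theorem cocone_aux2 {C D : Type*} [Category* C] [Category* D] {F G : C ⥤ D}
    (β : G ⟶ F) {X Y : C} (f : X ⟶ Y) {Z : D}
    (m : F.obj Y ⟶ Z) (k : F.obj X ⟶ Z) (h1 : F.map f ≫ m = k) :
    G.map f ≫ β.app Y ≫ m = β.app X ≫ k := by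
  rw [β.naturality_assoc, h1]

theorem cocone_aux3 {C D : Type*} [Category* C] [Category* D] {F G : C ⥤ D}
    (α : F ⟶ G) (β : G ⟶ F) (h : α ≫ β = 𝟙 F) {X : C} {Z : D} (m : F.obj X ⟶ Z) :
    m = α.app X ≫ β.app X ≫ m := by
  rw [← Category.assoc, ← NatTrans.comp_app, h, NatTrans.id_app, Category.id_comp]

theorem preservesColimit_of_functor_retract {C D J : Type*} [Category* C] [Category* D]
    [Category* J] {F G : C ⥤ D} (α : F ⟶ G) (β : G ⟶ F) (h : α ≫ β = 𝟙 F) (K : J ⥤ C)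
    [PreservesColimit K G] : PreservesColimit K F := by
  refine ⟨fun {c} hc => ⟨?_⟩⟩
  have hG := isColimitOfPreserves G hc
  let t (s : Cocone (K ⋙ F)) : Cocone (K ⋙ G) :=
    (Cocone.precompose (Functor.whiskerLeft K β)).obj s
  exact
    { desc := fun s => α.app c.pt ≫ hG.desc (t s)
      fac := fun s j => by
        have h1 : G.map (c.ι.app j) ≫ hG.desc (t s) = β.app (K.obj j) ≫ s.ι.app j :=
          hG.fac (t s) j
        exact cocone_aux1 α β h (c.ι.app j) (hG.desc (t s)) (s.ι.app j) h1
      uniq := fun s m hm => by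
        have h2 : β.app c.pt ≫ m = hG.desc (t s) := by
          refine hG.uniq (t s) _ (fun j => ?_)
          exact cocone_aux2 β (c.ι.app j) m (s.ι.app j) (hm j)
        rw [← h2]
        exact cocone_aux3 α β h m }

theorem retract_aux {C : Type*} [Category* C] {X Y Z : C} (p : X ⟶ Y) (q : Y ⟶ X) (e : Y ≅ Z)
    (h : p ≫ q = 𝟙 X) : (p ≫ e.hom) ≫ e.inv ≫ q = 𝟙 X := by
  simp [h]

/-- A presheaf `φ` on a small category `B` has `Hom(φ, -)` preserving all small colimits
(i.e. `φ` is a small projective) if and only if `φ` is a retract of a representable. -/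
theorem stmt5 (B : Type u) [SmallCategory B] (φ : Bᵒᵖ ⥤ Type u) :
    (∀ (J : Type u) (_ : SmallCategory J),
      PreservesColimitsOfShape J (coyoneda.obj (op φ))) ↔
    ∃ (b : B) (i : φ ⟶ yoneda.obj b) (r : yoneda.obj b ⟶ φ), i ≫ r = 𝟙 φ := by
  constructor
  · intro H
    have := H (φ.Elementsᵒᵖ) inferInstance
    obtain ⟨j, p, hp⟩ := Limits.exists_hom_of_preservesColimit_coyoneda
      (Presheaf.colimitOfRepresentable.{u} φ) (𝟙 φ)
    let e : uliftYoneda.{u}.obj j.unop.1.unop ≅ yoneda.obj j.unop.1.unop :=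
      NatIso.ofComponents (fun X => Equiv.toIso Equiv.ulift) (by intros; rfl)
    exact ⟨j.unop.1.unop, p ≫ e.hom, e.inv ≫ (Presheaf.coconeOfRepresentable.{u} φ).ι.app j,
      retract_aux p _ e hp⟩
  · rintro ⟨b, i, r, h⟩ J _
    have : PreservesColimitsOfShape J (coyoneda.obj (op (yoneda.obj b))) :=
      preservesColimitsOfShape_of_natIso
        (show (evaluation Bᵒᵖ (Type u)).obj (op b) ≅ coyoneda.obj (op (yoneda.obj b)) from
          (curriedYonedaLemma.app (op b)).symm)
    refine ⟨fun {K} => preservesColimit_of_functor_retract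
      (coyoneda.map r.op) (coyoneda.map i.op) ?_ K⟩
    rw [← Functor.map_comp, ← op_comp, h]
    exact coyoneda.map_id _
end

section
/- Let A and B be small categories. Then the presheaf categories (Aᵒᵖ ⥤ Type) and (Bᵒᵖ ⥤ Type) are equivalent if and only if the Karoubi envelopes Karoubi A and Karoubi B are equivalent. -/
open CategoryTheory CategoryTheory.Idempotents

universe u

namespace MoritaAux

open Limits Opposite

instance idemOfEq {D : Type*} [Category* D] [HasEqualizers D] : IsIdempotentComplete D :=
  (isIdempotentComplete_iff_hasEqualizer_of_id_and_idempotent D).2 fun _ _ _ => inferInstance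

section
variable (C : Type u) [SmallCategory C]

/-- The extension of the Yoneda embedding to Karoubi envelopes. -/
def L : Karoubi C ⥤ Karoubi (Cᵒᵖ ⥤ Type u) where
  obj P := ⟨yoneda.obj P.X, yoneda.map P.p, by rw [← Functor.map_comp, P.idem]⟩
  map {P Q} f := ⟨yoneda.map f.f, by
    change yoneda.map P.p ≫ yoneda.map f.f ≫ yoneda.map Q.p = yoneda.map f.f
    rw [← Functor.map_comp, ← Functor.map_comp, f.comm]⟩
  map_id P := rfl
  map_comp f g := by
    apply Karoubi.hom_ext
    exact yoneda.map_comp f.f g.f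

instance : (L C).Faithful where
  map_injective {P Q} f g h := by
    apply Karoubi.hom_ext
    exact yoneda.map_injective (congrArg Karoubi.Hom.f h)

instance : (L C).Full where
  map_surjective {P Q} f := by
    obtain ⟨g, hg⟩ := yoneda.map_surjective f.f
    refine ⟨⟨g, ?_⟩, ?_⟩
    · apply yoneda.map_injective
      rw [Functor.map_comp, Functor.map_comp, hg]
      exact f.comm
    · apply Karoubi.hom_ext
      exact hg

/-- The fully faithful embedding of the Karoubi envelope into presheaves. -/
noncomputable def K : Karoubi C ⥤ (Cᵒᵖ ⥤ Type u) :=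
  L C ⋙ (toKaroubiEquivalence (Cᵒᵖ ⥤ Type u)).inverse

instance : (K C).Faithful := by unfold K; infer_instance
instance : (K C).Full := by unfold K; infer_instance

variable {C}

theorem mem_iff (P : Cᵒᵖ ⥤ Type u) :
    (K C).essImage P ↔ ∃ b : C, Nonempty (Retract P (yoneda.obj b)) := by
  let e := toKaroubiEquivalence (Cᵒᵖ ⥤ Type u)
  constructor
  · rintro ⟨Q, ⟨i⟩⟩
    let i' : (L C).obj Q ≅ (toKaroubi _).obj P :=
      (e.counitIso.app ((L C).obj Q)).symm ≪≫ e.functor.mapIso i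
    have h1 : i'.hom.f ≫ i'.inv.f = yoneda.map Q.p := congrArg Karoubi.Hom.f i'.hom_inv_id
    have h2 : i'.inv.f ≫ i'.hom.f = 𝟙 P := congrArg Karoubi.Hom.f i'.inv_hom_id
    exact ⟨Q.X, ⟨⟨i'.inv.f, i'.hom.f, h2⟩⟩⟩
  · rintro ⟨b, ⟨r⟩⟩
    obtain ⟨p, hp⟩ := yoneda.map_surjective (r.r ≫ r.i)
    have hr := r.retract
    have hpp : p ≫ p = p := by
      apply yoneda.map_injective
      rw [Functor.map_comp, hp, Category.assoc, reassoc_of% hr]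
    let Q : Karoubi C := ⟨b, p, hpp⟩
    let i' : (L C).obj Q ≅ e.functor.obj P :=
      { hom := ⟨r.r, by
          change yoneda.map p ≫ r.r ≫ 𝟙 P = r.r
          rw [hp]; simp⟩
        inv := ⟨r.i, by
          change 𝟙 P ≫ r.i ≫ yoneda.map p = r.i
          rw [hp]; simp⟩
        hom_inv_id := by
          apply Karoubi.hom_ext
          exact hp.symm
        inv_hom_id := by
          apply Karoubi.hom_ext
          exact hr }
    exact ⟨Q, ⟨e.inverse.mapIso i' ≪≫ (e.unitIso.app P).symm⟩⟩

noncomputable def karoubiEquiv : Karoubi C ≌ (K C).essImage.FullSubcategory :=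
  haveI : (K C).toEssImage.IsEquivalence := {}
  (K C).toEssImage.asEquivalence

end

variable {A B : Type u} [SmallCategory A] [SmallCategory B]

theorem retract_rep (E : (Aᵒᵖ ⥤ Type u) ≌ (Bᵒᵖ ⥤ Type u)) (a : A) :
    ∃ b : B, Nonempty (Retract (E.functor.obj (yoneda.obj a)) (yoneda.obj b)) := by
  let P := E.functor.obj (yoneda.obj a)
  let H : (Bᵒᵖ ⥤ Type u) ⥤ Type u := E.inverse ⋙ (evaluation Aᵒᵖ (Type u)).obj (op a)
  have hc := isColimitOfPreserves H (Presheaf.isColimitTautologicalCocone P)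
  let x : H.obj P := yonedaEquiv (E.unit.app (yoneda.obj a))
  obtain ⟨j, y, hy⟩ := Types.jointly_surjective_of_isColimit hc x
  let f : yoneda.obj a ⟶ E.inverse.obj (yoneda.obj j.left) := yonedaEquiv.symm y
  have hf : f ≫ E.inverse.map j.hom = E.unit.app (yoneda.obj a) := by
    apply yonedaEquiv.injective
    have hfy : yonedaEquiv f = y := Equiv.apply_symm_apply _ _
    rw [yonedaEquiv_comp, hfy]
    exact hy
  refine ⟨j.left, ⟨⟨E.functor.map f ≫ E.counit.app _, j.hom, ?_⟩⟩⟩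
  have := E.counit.naturality j.hom
  dsimp at this
  rw [Category.assoc, ← this, ← Functor.map_comp_assoc, hf]
  exact E.functor_unit_comp _

theorem mem_of_mem (E : (Aᵒᵖ ⥤ Type u) ≌ (Bᵒᵖ ⥤ Type u)) (P : Aᵒᵖ ⥤ Type u)
    (h : (K A).essImage P) : (K B).essImage (E.functor.obj P) := by
  rw [mem_iff] at h ⊢
  obtain ⟨a, ⟨r⟩⟩ := h
  obtain ⟨b, ⟨s⟩⟩ := retract_rep E a
  exact ⟨b, ⟨(r.map E.functor).trans s⟩⟩

theorem invImage (E : (Aᵒᵖ ⥤ Type u) ≌ (Bᵒᵖ ⥤ Type u)) :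
    (K B).essImage.inverseImage E.functor = (K A).essImage := by
  ext P
  constructor
  · intro h
    exact (K A).essImage.prop_of_iso (E.unitIso.app P).symm (mem_of_mem E.symm _ h)
  · exact mem_of_mem E P

noncomputable def presheafKaroubi (C : Type u) [SmallCategory C] :
    (Cᵒᵖ ⥤ Type u)ᵒᵖ ≌ (Karoubi C ⥤ (Type u)ᵒᵖ) :=
  (Functor.leftOpRightOpEquiv C (Type u)).trans (karoubiUniversal C (Type u)ᵒᵖ)

end MoritaAux

/-- Classical Morita theorem: for small categories `A` and `B`, the presheaf categories
`Aᵒᵖ ⥤ Type` and `Bᵒᵖ ⥤ Type` are equivalent if and only if the Karoubi envelopes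
(Cauchy completions) of `A` and `B` are equivalent. -/
theorem stmt10 (A B : Type u) [SmallCategory A] [SmallCategory B] :
    Nonempty ((Aᵒᵖ ⥤ Type u) ≌ (Bᵒᵖ ⥤ Type u)) ↔ Nonempty (Karoubi A ≌ Karoubi B) := by
  constructor
  · rintro ⟨E⟩
    exact ⟨MoritaAux.karoubiEquiv.trans
      ((E.congrFullSubcategory (MoritaAux.invImage E)).trans MoritaAux.karoubiEquiv.symm)⟩
  · rintro ⟨e⟩
    exact ⟨((MoritaAux.presheafKaroubi A).trans
      (e.congrLeft.trans (MoritaAux.presheafKaroubi B).symm)).unop⟩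
end

section
/- Let A be a category, ι : C ⥤ A the inclusion of a full subcategory, and J a small category such that C admits all colimits of shape J. Let T : J ⥤ A be a diagram admitting a colimit in A, and suppose each object T j admits a reflection into C, i.e. there exist an object c_j of C and a morphism η_j : T j ⟶ ι c_j such that every morphism from T j to an object of the form ι c′ factors uniquely through η_j. Then the colimit of T also admits a reflection into C. -/
open CategoryTheory CategoryTheory.Limits

universe w v₁ v₂ u₁ u₂

/-- If `ι : C ⥤ A` is the inclusion of a full subcategory, `C` has colimits of shape `J`,
and `T : J ⥤ A` is a diagram with a colimit all of whose objects admit a reflection into `C`,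
then the colimit of `T` admits a reflection into `C`. -/
theorem stmt14 (A : Type u₁) [Category.{v₁} A] (C : Type u₂) [Category.{v₂} C]
    (ι : C ⥤ A) [ι.Full] [ι.Faithful]
    (J : Type w) [SmallCategory J] [HasColimitsOfShape J C]
    (T : J ⥤ A) [HasColimit T]
    (h : ∀ j : J, ∃ (c : C) (η : T.obj j ⟶ ι.obj c),
      ∀ (c' : C) (f : T.obj j ⟶ ι.obj c'), ∃! g : c ⟶ c', η ≫ ι.map g = f) :
    ∃ (c : C) (η : colimit T ⟶ ι.obj c),
      ∀ (c' : C) (f : colimit T ⟶ ι.obj c'), ∃! g : c ⟶ c', η ≫ ι.map g = f := by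
  choose c η hη using h
  have hext : ∀ (j : J) (c' : C) (g g' : c j ⟶ c'),
      η j ≫ ι.map g = η j ≫ ι.map g' → g = g' := fun j c' g g' e =>
    (hη j c' (η j ≫ ι.map g')).unique e rfl
  choose L hL _ using hη
  let S : J ⥤ C :=
    { obj := c
      map := fun {i j} u => L i (c j) (T.map u ≫ η j)
      map_id := fun j => by
        apply hext
        rw [hL]
        simp
      map_comp := fun {i j k} u v => by
        apply hext
        rw [hL, ι.map_comp, ← Category.assoc, hL, Category.assoc, hL]
        simp }
  have hS : ∀ {i j : J} (u : i ⟶ j), η i ≫ ι.map (S.map u) = T.map u ≫ η j :=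
    fun {i j} u => hL i (c j) (T.map u ≫ η j)
  let K : Cocone T :=
    { pt := ι.obj (colimit S)
      ι :=
        { app := fun j => η j ≫ ι.map (colimit.ι S j)
          naturality := fun i j u => by
            have h1 : T.map u ≫ η j ≫ ι.map (colimit.ι S j)
                = η i ≫ ι.map (colimit.ι S i) := by
              rw [← Category.assoc, ← hS u, Category.assoc]
              erw [← ι.map_comp]
              rw [colimit.w]
            simpa using h1 } }
  have hK : ∀ j, colimit.ι T j ≫ colimit.desc T K = η j ≫ ι.map (colimit.ι S j) :=
    fun j => colimit.ι_desc K j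
  refine ⟨colimit S, colimit.desc T K, fun c' f => ?_⟩
  let M : Cocone S :=
    { pt := c'
      ι :=
        { app := fun j => L j c' (colimit.ι T j ≫ f)
          naturality := fun i j u => by
            have h1 : S.map u ≫ L j c' (colimit.ι T j ≫ f) = L i c' (colimit.ι T i ≫ f) := by
              apply hext
              rw [hL, ι.map_comp, ← Category.assoc, hS u, Category.assoc, hL,
                ← Category.assoc, colimit.w]
            simpa using h1 } }
  have hM : ∀ j, colimit.ι S j ≫ colimit.desc S M = L j c' (colimit.ι T j ≫ f) :=
    fun j => colimit.ι_desc M j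
  refine ⟨colimit.desc S M, ?_, fun g hg => ?_⟩
  · apply colimit.hom_ext
    intro j
    rw [← Category.assoc, hK, Category.assoc]
    erw [← ι.map_comp]
    rw [hM, hL]
  · apply colimit.hom_ext
    intro j
    rw [hM]
    apply hext
    rw [hL, ← hg, ι.map_comp, ← Category.assoc, ← Category.assoc, hK]
end

section
/- Let J, E, and N be small categories such that N admits all colimits of shape J, and suppose colimits of shape E commute with limits of shape Jᵒᵖ in Type, i.e. for every functor F : E × Jᵒᵖ ⥤ Type the canonical comparison morphism from the colimit over E of the limits over Jᵒᵖ to the limit over Jᵒᵖ of the colimits over E is an isomorphism. Then for every diagram D : E ⥤ (Nᵒᵖ ⥤ Type) such that each presheaf D e preserves limits of shape Jᵒᵖ, the colimit of D in (Nᵒᵖ ⥤ Type) also preserves limits of shape Jᵒᵖ. -/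
open CategoryTheory CategoryTheory.Limits Opposite

universe u

/-- If colimits of shape `E` commute with limits of shape `Jᵒᵖ` in `Type` (the canonical
comparison map is an isomorphism for every `F : E × Jᵒᵖ ⥤ Type`), then for any diagram
`D : E ⥤ (Nᵒᵖ ⥤ Type)` whose values all preserve limits of shape `Jᵒᵖ`, the colimit of `D`
also preserves limits of shape `Jᵒᵖ`. -/
theorem stmt16 (J E N : Type u) [SmallCategory J] [SmallCategory E] [SmallCategory N]
    [HasColimitsOfShape J N]
    (hcomm : ∀ F : E × Jᵒᵖ ⥤ Type u,
      IsIso (colimitLimitToLimitColimit (CategoryTheory.Prod.swap Jᵒᵖ E ⋙ F)))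
    (D : E ⥤ (Nᵒᵖ ⥤ Type u)) (hD : ∀ e : E, PreservesLimitsOfShape Jᵒᵖ (D.obj e)) :
    PreservesLimitsOfShape Jᵒᵖ (colimit D) := by
  have key : PreservesLimitsOfShape Jᵒᵖ (colim : (E ⥤ Type u) ⥤ Type u) := by
    refine ⟨fun {G} => preservesLimit_of_preserves_limit_cone (limit.isLimit G) ?_⟩
    have h : IsIso (colimitLimitToLimitColimit (Functor.uncurry.obj G)) :=
      hcomm (CategoryTheory.Prod.swap E Jᵒᵖ ⋙ Functor.uncurry.obj G)
    have : IsIso (colimitLimitToLimitColimitCone G).hom := by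
      rw [colimitLimitToLimitColimitCone_hom]
      have h1 : IsIso (colim.map (limitIsoSwapCompLim G).hom) := inferInstance
      have h2 : IsIso (lim.map (Functor.whiskerRight
        (Functor.currying.unitIso.app G).inv (colim : (E ⥤ Type u) ⥤ Type u))) := inferInstance
      exact @IsIso.comp_isIso _ _ _ _ _ _ _ h1 (@IsIso.comp_isIso _ _ _ _ _ _ _ h h2)
    have := Cone.cone_iso_of_hom_iso (colimitLimitToLimitColimitCone G)
    exact IsLimit.ofIsoLimit (limit.isLimit _) (asIso (colimitLimitToLimitColimitCone G)).symm
  exact (ObjectProperty.preservesLimitsOfShape Jᵒᵖ).prop_colimit D hD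
end

section
/- Let N be a small category with an initial object ⊥, and let φ : Nᵒᵖ ⥤ Type be a presheaf. Then the set φ(⊥) is a singleton (nonempty and subsingleton) if and only if the category of elements CostructuredArrow yoneda φ is connected (nonempty, and any two objects are joined by a zigzag of morphisms). -/
open CategoryTheory CategoryTheory.Limits Opposite

universe u

/-- For a small category `N` with an initial object, a presheaf `φ : Nᵒᵖ ⥤ Type` takes a
singleton value at the initial object if and only if its category of elements
(`CostructuredArrow yoneda φ`) is connected. -/
theorem stmt18 (N : Type u) [SmallCategory N] [HasInitial N] (φ : Nᵒᵖ ⥤ Type u) :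
    (Nonempty (φ.obj (op (⊥_ N))) ∧ Subsingleton (φ.obj (op (⊥_ N)))) ↔
      IsConnected (CostructuredArrow yoneda φ) := by
  have key : (Nonempty (φ.obj (op (⊥_ N))) ∧ Subsingleton (φ.obj (op (⊥_ N)))) ↔
      (Nonempty (yoneda.obj (⊥_ N) ⟶ φ) ∧ Subsingleton (yoneda.obj (⊥_ N) ⟶ φ)) := by
    rw [yonedaEquiv.nonempty_congr, yonedaEquiv.subsingleton_congr]
  rw [key]
  let F : CostructuredArrow yoneda φ → (yoneda.obj (⊥_ N) ⟶ φ) :=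
    fun e => yoneda.map (initial.to e.left) ≫ e.hom
  constructor
  · rintro ⟨⟨a⟩, hs⟩
    have : Nonempty (CostructuredArrow yoneda φ) := ⟨CostructuredArrow.mk a⟩
    have h : ∀ e : CostructuredArrow yoneda φ, Zigzag (CostructuredArrow.mk a) e := fun e =>
      Zigzag.of_hom (CostructuredArrow.homMk (initial.to e.left) (hs.elim _ _))
    exact zigzag_isConnected fun e₁ e₂ => (h e₁).symm.trans (h e₂)
  · intro hc
    have hF : ∀ e₁ e₂, F e₁ = F e₂ := by
      intro e₁ e₂
      refine constant_of_preserves_morphisms F ?_ e₁ e₂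
      intro e₁ e₂ f
      have h1 : e₁.hom = yoneda.map f.left ≫ e₂.hom := (CostructuredArrow.w f).symm
      have h2 : initial.to e₁.left ≫ f.left = initial.to e₂.left := Subsingleton.elim _ _
      change yoneda.map _ ≫ e₁.hom = yoneda.map _ ≫ e₂.hom
      rw [h1, ← Category.assoc, ← Functor.map_comp, h2]
    have hF' : ∀ x : yoneda.obj (⊥_ N) ⟶ φ, F (CostructuredArrow.mk x) = x := by
      intro x
      have h2 : initial.to (⊥_ N) = 𝟙 _ := Subsingleton.elim _ _
      change yoneda.map (initial.to (⊥_ N)) ≫ x = x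
      rw [h2, CategoryTheory.Functor.map_id, Category.id_comp]
    refine ⟨⟨F (Classical.arbitrary _)⟩, ⟨fun x y => ?_⟩⟩
    rw [← hF' x, ← hF' y]
    exact hF _ _
end

section
/- Let G be a group with more than one element, viewed as a one-object category SingleObj G, so that (SingleObj G ⥤ Type) is the category of G-sets. Then the colimit functor colim : (SingleObj G ⥤ Type) ⥤ Type does not preserve limits of shape WalkingCospan; i.e. there is no instance of PreservesLimitsOfShape WalkingCospan colim. In particular, the pullback of the G-sets G → 1 ← G (G acting on itself by translation) is G × G, and applying the colimit (orbit set) functor to this pullback square does not yield a pullback square in Type. -/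
open CategoryTheory CategoryTheory.Limits

universe u

/-- The regular `G`-set. -/
def regG (G : Type u) [Group G] : SingleObj G ⥤ Type u where
  obj _ := G
  map {_ _} (f : G) := ↾(fun x : G => f * x)
  map_id _ := by
    ext x
    exact one_mul x
  map_comp {_ _ _} f h := by
    ext x
    exact mul_assoc (h : G) (f : G) x

/-- Right translation. -/
def rightG (G : Type u) [Group G] (g : G) : regG G ⟶ regG G where
  app _ := ↾(fun x : G => x * g)
  naturality _ _ f := by
    ext x
    exact mul_assoc (f : G) x g

/-- The difference `x⁻¹ y`. -/
def dG (G : Type u) [Group G] (x y : G) : G := x⁻¹ * y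

/-- Multiplication. -/
def mG (G : Type u) [Group G] (x y : G) : G := x * y

theorem dG_mG (G : Type u) [Group G] (x y z : G) : dG G (mG G x y) (mG G x z) = dG G y z := by
  unfold dG mG
  group

/-- The invariant `x⁻¹ y`. -/
def invG (G : Type u) [Group G] (P : SingleObj G ⥤ Type u) (a b : P ⟶ regG G) :
    P ⟶ (Functor.const (SingleObj G)).obj G where
  app j := ↾(fun p => dG G (a.app j p) (b.app j p))
  naturality j k f := by
    ext p
    have ha : a.app k (P.map f p) = mG G f (a.app j p) :=
      NatTrans.naturality_apply a f p
    have hb : b.app k (P.map f p) = mG G f (b.app j p) :=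
      NatTrans.naturality_apply b f p
    change dG G (a.app k (P.map f p)) (b.app k (P.map f p)) = dG G (a.app j p) (b.app j p)
    rw [ha, hb]
    exact dG_mG G _ _ _

theorem colim_rightG (G : Type u) [Group G] (g : G) :
    (colim : (SingleObj G ⥤ Type u) ⥤ Type u).map (rightG G g) = 𝟙 _ := by
  apply colimit.hom_ext
  intro j
  ext x
  have key : ∀ x : G, colimit.ι (regG G) j (x * g : G) = colimit.ι (regG G) j x := by
    intro x
    have h1 : colimit.ι (regG G) j (x * g * x⁻¹ * x : G) = colimit.ι (regG G) j x :=
      ConcreteCategory.congr_hom (colimit.w (regG G) (show j ⟶ j from (x * g * x⁻¹ : G))) x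
    rw [inv_mul_cancel_right] at h1
    exact h1
  have h2 := ConcreteCategory.congr_hom (colimit.ι_map (rightG G g) j) x
  exact h2.trans (key x)

/-- For a group `G` with more than one element, the colimit (orbit set) functor on the
category of `G`-sets does not preserve pullbacks, i.e. there is no instance of
`PreservesLimitsOfShape WalkingCospan` for `colim : (SingleObj G ⥤ Type) ⥤ Type`. -/
theorem stmt19 (G : Type u) [Group G] [Nontrivial G] :
    ¬ PreservesLimitsOfShape WalkingCospan
        (colim : (SingleObj G ⥤ Type u) ⥤ Type u) := by
  intro hP
  obtain ⟨g, hg⟩ := exists_ne (1 : G)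
  let t := terminal.from (regG G)
  have sq := IsPullback.of_hasPullback t t
  have sq' := sq.map (colim : (SingleObj G ⥤ Type u) ⥤ Type u)
  let l1 := pullback.lift (f := t) (g := t) (𝟙 (regG G)) (𝟙 _) rfl
  let l2 := pullback.lift (f := t) (g := t) (𝟙 (regG G)) (rightG G g) (Subsingleton.elim _ _)
  have e : (colim : (SingleObj G ⥤ Type u) ⥤ Type u).map l1 = colim.map l2 := by
    apply sq'.hom_ext
    · rw [← Functor.map_comp, ← Functor.map_comp, pullback.lift_fst, pullback.lift_fst]
    · rw [← Functor.map_comp, ← Functor.map_comp, pullback.lift_snd, pullback.lift_snd,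
        colim_rightG, CategoryTheory.Functor.map_id]
  let q := invG G _ (pullback.fst t t) (pullback.snd t t)
  let c : Cocone (pullback t t) := ⟨G, q⟩
  have key : l1 ≫ q = l2 ≫ q := by
    ext1
    ext1 j
    have := congrArg (fun k => colimit.ι (regG G) j ≫ k ≫ colimit.desc _ c) e
    have w : ∀ l : regG G ⟶ pullback t t,
        colimit.ι (regG G) j ≫ (colim : (SingleObj G ⥤ Type u) ⥤ Type u).map l ≫
          colimit.desc _ c = (l ≫ q).app j := by
      intro l
      erw [colimit.ι_map_assoc, colimit.ι_desc]
      rfl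
    rw [← w, ← w]
    exact this
  have k1 := ConcreteCategory.congr_hom (NatTrans.congr_app key (SingleObj.star G)) (1 : G)
  have f1 : ∀ x : G, (pullback.fst t t).app (SingleObj.star G) (l1.app (SingleObj.star G) x) = x :=
    fun x => ConcreteCategory.congr_hom
      (NatTrans.congr_app (pullback.lift_fst _ _ _ : l1 ≫ _ = _) (SingleObj.star G)) x
  have s1 : ∀ x : G, (pullback.snd t t).app (SingleObj.star G) (l1.app (SingleObj.star G) x) = x :=
    fun x => ConcreteCategory.congr_hom
      (NatTrans.congr_app (pullback.lift_snd _ _ _ : l1 ≫ _ = _) (SingleObj.star G)) x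
  have f2 : ∀ x : G, (pullback.fst t t).app (SingleObj.star G) (l2.app (SingleObj.star G) x) = x :=
    fun x => ConcreteCategory.congr_hom
      (NatTrans.congr_app (pullback.lift_fst _ _ _ : l2 ≫ _ = _) (SingleObj.star G)) x
  have s2 : ∀ x : G, (pullback.snd t t).app (SingleObj.star G) (l2.app (SingleObj.star G) x)
      = (x * g : G) :=
    fun x => ConcreteCategory.congr_hom
      (NatTrans.congr_app (pullback.lift_snd _ _ _ : l2 ≫ _ = _) (SingleObj.star G)) x
  change dG G ((pullback.fst t t).app (SingleObj.star G) (l1.app (SingleObj.star G) (1 : G)))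
      ((pullback.snd t t).app (SingleObj.star G) (l1.app (SingleObj.star G) (1 : G))) =
    dG G ((pullback.fst t t).app (SingleObj.star G) (l2.app (SingleObj.star G) (1 : G)))
      ((pullback.snd t t).app (SingleObj.star G) (l2.app (SingleObj.star G) (1 : G))) at k1
  rw [f1, s1, f2, s2] at k1
  have k2 : (1 : G)⁻¹ * 1 = (1 : G)⁻¹ * (1 * g) := k1
  simp at k2
  exact hg k2.symm
end
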